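/- Let Γ be a cocompact Fuchsian group, H a nontrivial finite subgroup of Γ, and M the unique maximal finite subgroup of Γ containing H. Then the normalizer N_Γ(H) equals M. -/

import Mathlib

open UpperHalfPlane Matrix

/-- `SL(2,ℝ)`: 2×2 real matrices of determinant 1. -/
abbrev SL2R := Matrix.SpecialLinearGroup (Fin 2) ℝ

/-- The subspace topology on `SL(2,ℝ)` inherited from 2×2 real matrices. -/
instance : TopologicalSpace SL2R :=
  TopologicalSpace.induced (fun g => (g : Matrix (Fin 2) (Fin 2) ℝ)) inferInstance

/-- `PSL(2,ℝ)`: the quotient of `SL(2,ℝ)` by its center `{±I}`,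
with the quotient topology. -/
abbrev PSL2R := SL2R ⧸ Subgroup.center SL2R

namespace NormFin

abbrev π : SL2R →* PSL2R := QuotientGroup.mk' (Subgroup.center SL2R)

lemma center_cases (z : SL2R) (hz : z ∈ Subgroup.center SL2R) :
    (z : Matrix (Fin 2) (Fin 2) ℝ) = 1 ∨ (z : Matrix (Fin 2) (Fin 2) ℝ) = -1 := by
  rw [Matrix.SpecialLinearGroup.mem_center_iff] at hz
  obtain ⟨r, hr, h⟩ := hz
  rw [← h]
  simp only [Fintype.card_fin] at hr
  rcases (sq_eq_sq_iff_eq_or_eq_neg.mp (hr.trans (one_pow 2).symm)) with h | h <;> subst h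
  · left; simp
  · right; rw [map_neg, map_one]

lemma lift_cases (g h : SL2R) (e : π g = π h) :
    (h : Matrix (Fin 2) (Fin 2) ℝ) = g ∨ (h : Matrix (Fin 2) (Fin 2) ℝ) = -g := by
  have := QuotientGroup.eq.mp e
  have h2 : (h : Matrix (Fin 2) (Fin 2) ℝ) = g * (g⁻¹ * h : SL2R) := by
    rw [← Matrix.SpecialLinearGroup.coe_mul]; simp
  rcases center_cases _ this with h' | h' <;> rw [h'] at h2 <;> simp [h2]

/-- `g` preserves the form `S`. -/
def Fx (S : Matrix (Fin 2) (Fin 2) ℝ) (g : SL2R) : Prop :=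
  (g : Matrix (Fin 2) (Fin 2) ℝ)ᵀ * S * (g : Matrix (Fin 2) (Fin 2) ℝ) = S

lemma Fx_eqs {S : Matrix (Fin 2) (Fin 2) ℝ} (hS : S 1 0 = S 0 1) {g : SL2R} (h : Fx S g) :
    S 0 0 * (g 1 1 - g 0 0) = 2 * S 0 1 * g 1 0 ∧ S 0 0 * g 0 1 = - (g 1 0 * S 1 1) := by
  have hd : g 0 0 * g 1 1 - g 0 1 * g 1 0 = 1 := by
    have := g.det_coe; rwa [Matrix.det_fin_two] at this
  have h00 := congrFun (congrFun h 0) 0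
  have h01 := congrFun (congrFun h 0) 1
  have h11 := congrFun (congrFun h 1) 1
  simp [Matrix.mul_apply, Fin.sum_univ_two, hS] at h00 h01 h11
  constructor
  · linear_combination (-g 1 1) * h00 + g 1 0 * h01 + (S 0 0 * g 0 0 + S 0 1 * g 1 0) * hd
  · linear_combination (-g 0 1) * h00 + g 0 0 * h01 - (S 0 1 * g 0 0 + S 1 1 * g 1 0) * hd

lemma comm {S : Matrix (Fin 2) (Fin 2) ℝ} (hp : 0 < S 0 0) (hS : S 1 0 = S 0 1) {g h : SL2R}
    (hg : Fx S g) (hh : Fx S h) : g * h = h * g := by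
  obtain ⟨a1, a2⟩ := Fx_eqs hS hg
  obtain ⟨b1, b2⟩ := Fx_eqs hS hh
  have e1 : g 1 1 = g 0 0 + 2 * S 0 1 * g 1 0 / S 0 0 := by field_simp; linarith
  have e2 : g 0 1 = - (g 1 0 * S 1 1) / S 0 0 := by field_simp; linarith
  have e3 : h 1 1 = h 0 0 + 2 * S 0 1 * h 1 0 / S 0 0 := by field_simp; linarith
  have e4 : h 0 1 = - (h 1 0 * S 1 1) / S 0 0 := by field_simp; linarith
  ext i j
  fin_cases i <;> fin_cases j <;>
    simp [Matrix.mul_apply, Fin.sum_univ_two, e1, e2, e3, e4] <;> ring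

lemma Fx_unique {S T : Matrix (Fin 2) (Fin 2) ℝ} (hp : 0 < S 0 0) (hS : S 1 0 = S 0 1)
    (hp' : 0 < T 0 0) (hT : T 1 0 = T 0 1) (hdet : T.det = S.det) (hdp : 0 < S.det)
    {g : SL2R} (hg : Fx S g) (hg' : Fx T g) (hn : g ∉ Subgroup.center SL2R) : T = S := by
  obtain ⟨a1, a2⟩ := Fx_eqs hS hg
  obtain ⟨b1, b2⟩ := Fx_eqs hT hg'
  have hc : g 1 0 ≠ 0 := by
    intro hc
    apply hn
    have e1 : g 1 1 = g 0 0 := by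
      rw [hc] at a1; have : g 1 1 - g 0 0 = 0 := by simpa [hp.ne'] using a1
      linarith
    have e2 : g 0 1 = 0 := by rw [hc] at a2; simpa [hp.ne'] using a2
    have hd : g 0 0 * g 1 1 - g 0 1 * g 1 0 = 1 := by
      have := g.det_coe; rwa [Matrix.det_fin_two] at this
    rw [Matrix.SpecialLinearGroup.mem_center_iff]
    refine ⟨g 0 0, ?_, ?_⟩
    · simp only [Fintype.card_fin]; rw [e1, e2] at hd; linarith
    · ext i j
      fin_cases i <;> fin_cases j <;> simp [e1, e2, hc]
  have q1 : S 0 0 * T 0 1 = T 0 0 * S 0 1 := by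
    apply mul_right_cancel₀ hc; linear_combination (T 0 0 * a1 - S 0 0 * b1) / 2
  have q2 : S 0 0 * T 1 1 = T 0 0 * S 1 1 := by
    apply mul_right_cancel₀ hc; linear_combination (S 0 0 * b2 - T 0 0 * a2)
  rw [Matrix.det_fin_two] at hdp
  rw [Matrix.det_fin_two, Matrix.det_fin_two, hS, hT] at hdet
  rw [hS] at hdp
  have q3 : (T 0 0) ^ 2 = (S 0 0) ^ 2 := by
    apply mul_right_cancel₀ hdp.ne'
    linear_combination (S 0 0)^2 * hdet - S 0 0 * T 0 0 * q2 + (S 0 0 * T 0 1 + T 0 0 * S 0 1) * q1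
  have q4 : T 0 0 = S 0 0 := by
    rwa [sq_eq_sq₀ hp'.le hp.le] at q3
  rw [q4] at q1 q2
  have q5 := mul_left_cancel₀ hp.ne' q1
  have q6 := mul_left_cancel₀ hp.ne' q2
  ext i j
  fin_cases i <;> fin_cases j <;> simp [q4, q5, q6, hS, hT]

lemma symm_of {S : Matrix (Fin 2) (Fin 2) ℝ} (h : S.PosDef) : S 1 0 = S 0 1 := by
  have := h.isHermitian.apply 0 1; simpa using this

lemma Fx_normal {S : Matrix (Fin 2) (Fin 2) ℝ} (h : S.PosDef) {g n : SL2R}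
    (hg : Fx S g) (hk : Fx S (n * g * n⁻¹)) (hn : g ∉ Subgroup.center SL2R) : Fx S n := by
  have hT : ((n : Matrix (Fin 2) (Fin 2) ℝ)ᵀ * S * (n : Matrix (Fin 2) (Fin 2) ℝ)).PosDef := by
    have := h.conjTranspose_mul_mul_same (B := (n : Matrix (Fin 2) (Fin 2) ℝ)) (by
      apply Matrix.mulVec_injective_of_isUnit
      rw [Matrix.isUnit_iff_isUnit_det]; simp)
    simpa using this
  refine Fx_unique h.diag_pos (symm_of h) hT.diag_pos (symm_of hT) (by simp) h.det_pos hg ?_ hn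
  have e : (n : Matrix (Fin 2) (Fin 2) ℝ) * g = (n * g * n⁻¹ : SL2R) * n := by
    rw [← Matrix.SpecialLinearGroup.coe_mul, ← Matrix.SpecialLinearGroup.coe_mul]; simp
  unfold Fx at hk ⊢
  calc _ = ((n : Matrix (Fin 2) (Fin 2) ℝ) * (g : Matrix (Fin 2) (Fin 2) ℝ))ᵀ * S * ((n : Matrix (Fin 2) (Fin 2) ℝ) * (g : Matrix (Fin 2) (Fin 2) ℝ)) := by
        simp only [Matrix.transpose_mul, Matrix.mul_assoc]
    _ = (n : Matrix (Fin 2) (Fin 2) ℝ)ᵀ * (((n * g * n⁻¹ : SL2R) : Matrix (Fin 2) (Fin 2) ℝ)ᵀ * S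
          * ((n * g * n⁻¹ : SL2R) : Matrix (Fin 2) (Fin 2) ℝ)) * (n : Matrix (Fin 2) (Fin 2) ℝ) := by
        rw [e]; simp only [Matrix.transpose_mul, Matrix.mul_assoc]
    _ = _ := by rw [hk]

lemma exists_form (M : Subgroup PSL2R) [Finite M] :
    ∃ S : Matrix (Fin 2) (Fin 2) ℝ, S.PosDef ∧ ∀ g : SL2R, π g ∈ M → Fx S g := by
  have := Fintype.ofFinite M
  have hsurj : Function.Surjective π := QuotientGroup.mk'_surjective _
  choose l hl using hsurj
  refine ⟨∑ m : M, (l m : Matrix (Fin 2) (Fin 2) ℝ)ᵀ * (l m : Matrix (Fin 2) (Fin 2) ℝ), ?_, ?_⟩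
  · apply Matrix.posDef_sum
    · exact Finset.univ_nonempty
    · intro m _
      have := Matrix.PosDef.conjTranspose_mul_self (l m : Matrix (Fin 2) (Fin 2) ℝ) (by
        apply Matrix.mulVec_injective_of_isUnit
        rw [Matrix.isUnit_iff_isUnit_det]; simp)
      simpa using this
  · intro g hg
    unfold Fx
    rw [Finset.mul_sum, Finset.sum_mul]
    refine Fintype.sum_equiv (Equiv.mulRight (⟨π g, hg⟩ : M)) _ _ ?_
    intro m
    have := lift_cases (l m * g) (l (m * π g)) (by rw [hl, map_mul, hl])
    simp only [Equiv.coe_mulRight, Subgroup.coe_mul]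
    rcases this with h | h <;> rw [h] <;>
      simp [Matrix.transpose_mul, Matrix.mul_assoc]

lemma isInd : Topology.IsClosedEmbedding
    (fun g : SL2R => (g : Matrix (Fin 2) (Fin 2) ℝ)) := by
  refine ⟨⟨⟨rfl⟩, fun a b h => Subtype.ext h⟩, ?_⟩
  have : Set.range (fun g : SL2R => (g : Matrix (Fin 2) (Fin 2) ℝ)) = {A | A.det = 1} := by
    ext A; constructor
    · rintro ⟨g, rfl⟩; exact g.det_coe
    · intro h; exact ⟨⟨A, h⟩, rfl⟩
  rw [this]
  exact isClosed_eq (by fun_prop) continuous_const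

lemma topGroup : IsTopologicalGroup SL2R :=
  Matrix.SpecialLinearGroup.topologicalGroup

lemma compact_Fx {S : Matrix (Fin 2) (Fin 2) ℝ} (h : S.PosDef) : IsCompact {g : SL2R | Fx S g} := by
  have : IsCompact {A : Matrix (Fin 2) (Fin 2) ℝ | Aᵀ * S * A = S} := by
    have hp : 0 < S 0 0 := h.diag_pos
    have hd : 0 < S.det := h.det_pos
    have hs := symm_of h
    rw [Matrix.det_fin_two, hs] at hd
    have hr : 0 < S 1 1 := h.diag_pos
    set C := (S 0 0 + S 1 1)^2 / (S 0 0 * S 1 1 - S 0 1 * S 0 1) with hC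
    refine IsCompact.of_isClosed_subset (s := Set.univ.pi fun _ => Set.univ.pi fun _ =>
      Set.Icc (-(C+1)) (C+1)) (isCompact_univ_pi fun _ => isCompact_univ_pi fun _ => isCompact_Icc)
      (isClosed_eq (by fun_prop) continuous_const) ?_
    intro (A : Matrix (Fin 2) (Fin 2) ℝ) hA
    replace hA : Aᵀ * S * A = S := hA
    have h00 := congrFun (congrFun hA 0) 0
    have h11 := congrFun (congrFun hA 1) 1
    simp only [Matrix.mul_apply, Fin.sum_univ_two, hs, Matrix.transpose_apply] at h00 h11
    have key : ∀ x y t : ℝ, S 0 0 * x^2 + 2 * S 0 1 * x * y + S 1 1 * y^2 = t →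
        t ≤ S 0 0 + S 1 1 → x ^ 2 ≤ C ∧ y ^ 2 ≤ C := by
      intro x y t ht htt
      rw [hC, le_div_iff₀ hd, le_div_iff₀ hd]
      have k1 : S 1 1 * t ≤ (S 0 0 + S 1 1)^2 := by nlinarith
      have k2 : S 0 0 * t ≤ (S 0 0 + S 1 1)^2 := by nlinarith
      constructor
      · nlinarith [sq_nonneg (S 0 1 * x + S 1 1 * y)]
      · nlinarith [sq_nonneg (S 0 0 * x + S 0 1 * y)]
    have k0 := key (A 0 0) (A 1 0) (S 0 0) (by linear_combination h00) (by linarith)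
    have k1 := key (A 0 1) (A 1 1) (S 1 1) (by linear_combination h11) (by linarith)
    have fin : ∀ x : ℝ, x^2 ≤ C → x ∈ Set.Icc (-(C+1)) (C+1) := by
      intro x hx
      constructor <;> nlinarith [sq_nonneg (x-1), sq_nonneg (x+1)]
    intro i _ j _
    fin_cases i <;> fin_cases j
    · exact fin _ k0.1
    · exact fin _ k1.1
    · exact fin _ k0.2
    · exact fin _ k1.2
  exact isInd.isCompact_preimage this

lemma t2 : T2Space PSL2R := by
  have := topGroup
  have : T2Space SL2R := isInd.isEmbedding.t2Space
  have : IsClosed ((Subgroup.center SL2R : Subgroup SL2R) : Set SL2R) := by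
    have : ((Subgroup.center SL2R : Subgroup SL2R) : Set SL2R) = ⋂ g : SL2R, {z | g * z = z * g} := by
      ext z; simp [Subgroup.mem_center_iff]
    rw [this]
    exact isClosed_iInter fun g => isClosed_eq (by fun_prop) (by fun_prop)
  infer_instance

lemma finite_inter (Γ : Subgroup PSL2R) (hd : DiscreteTopology Γ)
    {S : Matrix (Fin 2) (Fin 2) ℝ} (h : S.PosDef) :
    ((Γ : Set PSL2R) ∩ π '' {g : SL2R | Fx S g}).Finite := by
  have := topGroup
  have := t2
  have hK : IsCompact (π '' {g : SL2R | Fx S g}) :=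
    (compact_Fx h).image QuotientGroup.continuous_mk
  have hcl : IsClosed (Γ : Set PSL2R) := Subgroup.isClosed_of_discrete
  have hc := hK.inter_left hcl
  apply hc.finite
  exact IsDiscrete.mono ⟨hd⟩ Set.inter_subset_left

end NormFin

open NormFin in
theorem normalizer_eq_maximal_finite
    (Γ : Subgroup PSL2R) (hd : DiscreteTopology Γ) (hc : CompactSpace (PSL2R ⧸ Γ))
    (H : Subgroup PSL2R) (hHΓ : H ≤ Γ) (hHbot : H ≠ ⊥) (hHfin : Finite H)
    (M : Subgroup PSL2R) (hMΓ : M ≤ Γ) (hMfin : Finite M) (hHM : H ≤ M)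
    (hMmax : ∀ K : Subgroup PSL2R, K ≤ Γ → Finite K → M ≤ K → K = M) :
    Γ ⊓ Subgroup.normalizer (H : Set PSL2R) = M := by
  obtain ⟨S, hS, hM⟩ := exists_form M
  have hsurj : Function.Surjective π := QuotientGroup.mk'_surjective _
  apply hMmax _ inf_le_left
  · refine ((finite_inter Γ hd hS).subset ?_).to_subtype
    rintro x ⟨hx, hxn⟩
    refine ⟨hx, ?_⟩
    obtain ⟨n, rfl⟩ := hsurj x
    refine ⟨n, ?_, rfl⟩
    obtain ⟨y, hy, hy1⟩ := (Subgroup.ne_bot_iff_exists_ne_one (H := H)).mp hHbot |>.elim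
      fun a ha => (⟨a.1, a.2, fun h => ha (Subtype.ext h)⟩ : ∃ y, y ∈ H ∧ y ≠ 1)
    obtain ⟨g, rfl⟩ := hsurj y
    refine Fx_normal hS (hM g (hHM hy)) (hM _ (hHM ?_)) ?_
    · rw [map_mul, map_mul, map_inv]
      exact (Subgroup.mem_normalizer_iff.mp hxn _).mp hy
    · intro hg
      exact hy1 ((QuotientGroup.eq_one_iff g).mpr hg)
  · refine le_inf hMΓ ?_
    have hcomm : ∀ x ∈ M, ∀ y ∈ M, x * y = y * x := by
      intro x hx y hy
      obtain ⟨g, rfl⟩ := hsurj x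
      obtain ⟨k, rfl⟩ := hsurj y
      rw [← map_mul, ← map_mul, comm hS.diag_pos (symm_of hS) (hM g hx) (hM k hy)]
    intro x hx
    rw [Subgroup.mem_normalizer_iff]
    intro y
    constructor
    · intro hy
      rwa [hcomm x hx y (hHM hy), mul_inv_cancel_right]
    · intro hy
      have h1 := hcomm x⁻¹ (M.inv_mem hx) _ (hHM hy)
      have h2 : y = x * y * x⁻¹ := by
        have : x⁻¹ * (x * y * x⁻¹) * x = y := by group
        rw [h1] at this
        rw [inv_mul_cancel_right] at this
        exact this.symm
      rwa [h2]
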